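/- arXiv:2202.07821 — 2 statements merged into one kernel-verified Lean document; each statement's English description precedes it below -/
import Mathlib

section
/- Let 0 < α < β. Then for all p, q ∈ S⁺_n with αI ≤ p ≤ βI and αI ≤ q ≤ βI, one has d(p,q) ≤ √n · ln(β/α); moreover d(αI, βI) = √n · ln(β/α). Consequently, the diameter of the order interval [αI,βI] with respect to d equals √n · ln(β/α). -/
open Matrix Real Filter

namespace SPD

variable {n : ℕ}

/-- Apply a real function to a symmetric matrix via the spectral calculus
(junk value `0` on non-Hermitian input). -/
noncomputable def mfun (p : Matrix (Fin n) (Fin n) ℝ) (f : ℝ → ℝ) : Matrix (Fin n) (Fin n) ℝ :=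
  if hp : p.IsHermitian then hp.cfc f else 0

/-- The positive definite square root. -/
noncomputable def msqrt (p : Matrix (Fin n) (Fin n) ℝ) : Matrix (Fin n) (Fin n) ℝ :=
  mfun p Real.sqrt

/-- The eigenvalues of a symmetric matrix (junk value `0` on non-Hermitian input). -/
noncomputable def eigs (p : Matrix (Fin n) (Fin n) ℝ) : Fin n → ℝ :=
  if hp : p.IsHermitian then hp.eigenvalues else 0

/-- The Loewner order: `p ≤ q` iff `q - p` is positive semidefinite. -/
def Loewner (p q : Matrix (Fin n) (Fin n) ℝ) : Prop := (q - p).PosSemidef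

/-- The Riemannian (trace-metric) distance on positive definite matrices:
`d(p,q) = (∑ i, (ln λ_i(p^{-1/2} q p^{-1/2}))²)^{1/2}`. -/
noncomputable def dR (p q : Matrix (Fin n) (Fin n) ℝ) : ℝ :=
  Real.sqrt (∑ i, (Real.log (eigs ((msqrt p)⁻¹ * q * (msqrt p)⁻¹) i)) ^ 2)

/-- The θ-weighted geometric mean `p #_θ q = p^{1/2} (p^{-1/2} q p^{-1/2})^θ p^{1/2}`. -/
noncomputable def gmean (θ : ℝ) (p q : Matrix (Fin n) (Fin n) ℝ) : Matrix (Fin n) (Fin n) ℝ :=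
  msqrt p * mfun ((msqrt p)⁻¹ * q * (msqrt p)⁻¹) (fun x => x ^ θ) * msqrt p

/-- The singular values of a matrix in decreasing order: `svals M i` is `α_{i+1}(M)`,
so `svals M ⟨0,_⟩ = α₁(M) ≥ … ≥ svals M ⟨n-1,_⟩ = α_n(M)`. -/
noncomputable def svals (M : Matrix (Fin n) (Fin n) ℝ) : Fin n → ℝ := fun i =>
  Real.sqrt ((eigs (Mᵀ * M) ∘ Tuple.sort (eigs (Mᵀ * M))) i.rev)

/-- The operator (spectral) norm: the largest singular value. -/
noncomputable def opNorm (M : Matrix (Fin n) (Fin n) ℝ) : ℝ :=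
  if h : 0 < n then svals M ⟨0, h⟩ else 0

/-- The trace-metric inner product `⟨u,v⟩_p = tr(p⁻¹ u p⁻¹ v)`. -/
noncomputable def minner (p u v : Matrix (Fin n) (Fin n) ℝ) : ℝ :=
  (p⁻¹ * u * p⁻¹ * v).trace

/-- The trace-metric norm `‖v‖_p`. -/
noncomputable def mnorm (p v : Matrix (Fin n) (Fin n) ℝ) : ℝ :=
  Real.sqrt (minner p v v)

/-- The Riemannian exponential `exp_p(v) = p^{1/2} exp(p^{-1/2} v p^{-1/2}) p^{1/2}`. -/
noncomputable def mexpP (p v : Matrix (Fin n) (Fin n) ℝ) : Matrix (Fin n) (Fin n) ℝ :=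
  msqrt p * mfun ((msqrt p)⁻¹ * v * (msqrt p)⁻¹) Real.exp * msqrt p

/-- The Riemannian logarithm `log_p(q) = p^{1/2} log(p^{-1/2} q p^{-1/2}) p^{1/2}`. -/
noncomputable def mlogP (p q : Matrix (Fin n) (Fin n) ℝ) : Matrix (Fin n) (Fin n) ℝ :=
  msqrt p * mfun ((msqrt p)⁻¹ * q * (msqrt p)⁻¹) Real.log * msqrt p

/-- `s` is a subgradient of `f` at `p`:  `f(q) ≥ f(p) + ⟨s, log_p q⟩_p` for all `q ∈ S⁺_n`. -/
def IsSubgrad (f : Matrix (Fin n) (Fin n) ℝ → ℝ) (p s : Matrix (Fin n) (Fin n) ℝ) : Prop :=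
  s.IsHermitian ∧ ∀ q : Matrix (Fin n) (Fin n) ℝ, q.PosDef → f p + minner p s (mlogP p q) ≤ f q

/-- Geodesic convexity of a function on `S⁺_n`. -/
def GConvexFun (f : Matrix (Fin n) (Fin n) ℝ → ℝ) : Prop :=
  ∀ p q : Matrix (Fin n) (Fin n) ℝ, p.PosDef → q.PosDef → ∀ θ ∈ Set.Icc (0:ℝ) 1,
    f (gmean θ p q) ≤ (1 - θ) * f p + θ * f q

/-- Geodesic convexity of a subset of `S⁺_n`. -/
def GConvexSet (X : Set (Matrix (Fin n) (Fin n) ℝ)) : Prop :=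
  ∀ p ∈ X, ∀ q ∈ X, ∀ θ ∈ Set.Icc (0:ℝ) 1, gmean θ p q ∈ X

/-- `κ̂ = 1/√2`, the square root of the absolute value of the curvature lower bound `-1/2`. -/
noncomputable def khat : ℝ := (Real.sqrt 2)⁻¹

/-- The inexact projected subgradient iteration: `p₀ ∈ X`; `v_k = s_k + u_k ≠ 0` with
`s_k ∈ ∂f(p_k)` and symmetric error `u_k`; `p̃_{k+1} = exp_{p_k}(−t_k·v_k/‖v_k‖_{p_k})`;
and `p_{k+1} ∈ X` is a nearest point of `X` to `p̃_{k+1}` w.r.t. `d`. -/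
structure Iter (f : Matrix (Fin n) (Fin n) ℝ → ℝ) (X : Set (Matrix (Fin n) (Fin n) ℝ))
    (p s u : ℕ → Matrix (Fin n) (Fin n) ℝ) (t : ℕ → ℝ) : Prop where
  p0_mem : p 0 ∈ X
  subgrad : ∀ k, IsSubgrad f (p k) (s k)
  u_herm : ∀ k, (u k).IsHermitian
  v_ne : ∀ k, s k + u k ≠ 0
  proj_mem : ∀ k, p (k + 1) ∈ X
  proj_nearest : ∀ k, ∀ q ∈ X,
    dR (mexpP (p k) (-(t k / mnorm (p k) (s k + u k)) • (s k + u k))) (p (k + 1)) ≤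
      dR (mexpP (p k) (-(t k / mnorm (p k) (s k + u k)) • (s k + u k))) q

end SPD

open SPD

/-- The square root of a positive definite matrix is symmetric and squares to the matrix. -/
lemma msqrt_spec {n : ℕ} (p : Matrix (Fin n) (Fin n) ℝ) (hp : p.PosDef) :
    (msqrt p).IsHermitian ∧ msqrt p * msqrt p = p := by
  have hh := hp.isHermitian
  have e : msqrt p = hh.cfc Real.sqrt := by
    unfold msqrt mfun
    rw [dif_pos hh]
  constructor
  · rw [e, ← hh.cfc_eq]
    exact cfc_predicate (p := IsSelfAdjoint) Real.sqrt p
  · rw [e]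
    unfold Matrix.IsHermitian.cfc
    rw [← map_mul, diagonal_mul_diagonal]
    conv_rhs => rw [hh.spectral_theorem]
    congr 2
    funext i
    simp only [Function.comp_apply]
    have h0 := (hp.eigenvalues_pos i).le
    simpa using Real.mul_self_sqrt h0

/-- Each eigenvalue in the definition of `dR` is a generalized Rayleigh quotient. -/
lemma eig_rayleigh {n : ℕ} (p q : Matrix (Fin n) (Fin n) ℝ) (hp : p.PosDef) (hq : q.IsHermitian)
    (i : Fin n) : ∃ w : Fin n → ℝ, w ≠ 0 ∧
      w ⬝ᵥ (q *ᵥ w) = eigs ((msqrt p)⁻¹ * q * (msqrt p)⁻¹) i * (w ⬝ᵥ (p *ᵥ w)) := by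
  obtain ⟨hS, hSS⟩ := msqrt_spec p hp
  set S := msqrt p with hSdef
  have hu : IsUnit S.det := by
    have h1 : IsUnit p.det := (Matrix.isUnit_iff_isUnit_det p).1 hp.isUnit
    rw [← hSS, Matrix.det_mul] at h1
    exact isUnit_of_mul_isUnit_left h1
  have hST : Sᵀ = S := by simpa [Matrix.IsHermitian] using hS
  have hM : (S⁻¹ * q * S⁻¹).IsHermitian := by
    have h := Matrix.isHermitian_mul_mul_conjTranspose S⁻¹ hq
    rwa [hS.inv.eq] at h
  have e : eigs (S⁻¹ * q * S⁻¹) i = hM.eigenvalues i := by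
    unfold eigs
    rw [dif_pos hM]
  rw [e]
  have hv := hM.mulVec_eigenvectorBasis i
  have hv0 : (hM.eigenvectorBasis i).ofLp ≠ 0 := by
    intro h
    apply hM.eigenvectorBasis.toBasis.ne_zero i
    ext j
    simpa using congrFun h j
  set v := (hM.eigenvectorBasis i).ofLp with hvdef
  set l := hM.eigenvalues i
  have hSw : S *ᵥ (S⁻¹ *ᵥ v) = v := by
    rw [Matrix.mulVec_mulVec, Matrix.mul_nonsing_inv _ hu, Matrix.one_mulVec]
  refine ⟨S⁻¹ *ᵥ v, ?_, ?_⟩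
  · intro h
    rw [h, Matrix.mulVec_zero] at hSw
    exact hv0 hSw.symm
  · have hqw : q *ᵥ (S⁻¹ *ᵥ v) = l • (S *ᵥ v) := by
      rw [← Matrix.mulVec_smul, ← hv, Matrix.mulVec_mulVec, Matrix.mulVec_mulVec,
        ← Matrix.mul_assoc, ← Matrix.mul_assoc, Matrix.mul_nonsing_inv _ hu, Matrix.one_mul]
    have hpw : p *ᵥ (S⁻¹ *ᵥ v) = S *ᵥ v := by
      conv_lhs => rw [← hSS]
      rw [← Matrix.mulVec_mulVec, hSw]
    rw [hqw, hpw, dotProduct_smul, smul_eq_mul]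

/-- Loewner order gives an inequality of quadratic forms. -/
lemma loewner_quad {n : ℕ} {a b : Matrix (Fin n) (Fin n) ℝ} (h : Loewner a b) (w : Fin n → ℝ) :
    w ⬝ᵥ (a *ᵥ w) ≤ w ⬝ᵥ (b *ᵥ w) := by
  have := Matrix.PosSemidef.dotProduct_mulVec_nonneg h w
  rw [Matrix.sub_mulVec, dotProduct_sub] at this
  simpa using this

lemma quad_smul_one {n : ℕ} (a : ℝ) (w : Fin n → ℝ) :
    w ⬝ᵥ ((a • (1 : Matrix (Fin n) (Fin n) ℝ)) *ᵥ w) = a * (w ⬝ᵥ w) := by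
  rw [Matrix.smul_mulVec, Matrix.one_mulVec, dotProduct_smul, smul_eq_mul]

lemma dot_self_pos {n : ℕ} {w : Fin n → ℝ} (h : w ≠ 0) : 0 < w ⬝ᵥ w := by
  have h1 : 0 ≤ w ⬝ᵥ w := Finset.sum_nonneg fun i _ => mul_self_nonneg _
  exact lt_of_le_of_ne h1 fun h2 => h (dotProduct_self_eq_zero.1 h2.symm)

/-- The diameter of the order interval `[αI, βI]` equals `√n · ln(β/α)`:
every pair of points has distance at most `√n · ln(β/α)`, and `d(αI, βI) = √n · ln(β/α)`. -/
theorem diam_order_interval {n : ℕ} (α β : ℝ) (hα : 0 < α) (hαβ : α < β) :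
    (∀ p q : Matrix (Fin n) (Fin n) ℝ, p.PosDef → q.PosDef →
        Loewner (α • (1 : Matrix (Fin n) (Fin n) ℝ)) p →
        Loewner p (β • (1 : Matrix (Fin n) (Fin n) ℝ)) →
        Loewner (α • (1 : Matrix (Fin n) (Fin n) ℝ)) q →
        Loewner q (β • (1 : Matrix (Fin n) (Fin n) ℝ)) →
        dR p q ≤ Real.sqrt n * Real.log (β / α))
    ∧ dR (α • (1 : Matrix (Fin n) (Fin n) ℝ)) (β • (1 : Matrix (Fin n) (Fin n) ℝ))
        = Real.sqrt n * Real.log (β / α) := by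
  have hβ : 0 < β := hα.trans hαβ
  have hL : 0 ≤ Real.log (β / α) := Real.log_nonneg ((one_le_div hα).2 hαβ.le)
  have hroot : Real.sqrt (∑ _i : Fin n, (Real.log (β / α)) ^ 2)
      = Real.sqrt n * Real.log (β / α) := by
    rw [Finset.sum_const, Finset.card_univ, Fintype.card_fin, nsmul_eq_mul,
      Real.sqrt_mul (Nat.cast_nonneg n), Real.sqrt_sq hL]
  constructor
  · intro p q hp hq h1 h2 h3 h4
    rw [← hroot]
    unfold dR
    apply Real.sqrt_le_sqrt
    apply Finset.sum_le_sum
    intro i _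
    obtain ⟨w, hw, he⟩ := eig_rayleigh p q hp hq.isHermitian i
    set l := eigs ((msqrt p)⁻¹ * q * (msqrt p)⁻¹) i
    have k1 := loewner_quad h1 w
    have k2 := loewner_quad h2 w
    have k3 := loewner_quad h3 w
    have k4 := loewner_quad h4 w
    rw [quad_smul_one] at k1 k2 k3 k4
    rw [he] at k3 k4
    have hN := dot_self_pos hw
    set N := w ⬝ᵥ w
    set P := w ⬝ᵥ (p *ᵥ w)
    have hP : 0 < P := lt_of_lt_of_le (mul_pos hα hN) k1
    have hl : 0 < l := by
      have : 0 < l * P := lt_of_lt_of_le (mul_pos hα hN) k3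
      exact pos_of_mul_pos_left this hP.le
    have hup : l ≤ β / α := by
      rw [le_div_iff₀ hα]
      have : l * (α * N) ≤ l * P := mul_le_mul_of_nonneg_left k1 hl.le
      nlinarith
    have hlo : (β / α)⁻¹ ≤ l := by
      rw [inv_div, div_le_iff₀ hβ]
      have : l * P ≤ l * (β * N) := mul_le_mul_of_nonneg_left k2 hl.le
      nlinarith
    have g1 := Real.log_le_log hl hup
    have g2 := Real.log_le_log (inv_pos.2 (div_pos hβ hα)) hlo
    rw [Real.log_inv] at g2
    exact sq_le_sq' g2 g1
  · rw [← hroot]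
    unfold dR
    congr 1
    apply Finset.sum_congr rfl
    intro i _
    have hpa : (α • (1 : Matrix (Fin n) (Fin n) ℝ)).PosDef := Matrix.PosDef.one.smul hα
    have hqb : (β • (1 : Matrix (Fin n) (Fin n) ℝ)).PosDef := Matrix.PosDef.one.smul hβ
    obtain ⟨w, hw, he⟩ := eig_rayleigh _ _ hpa hqb.isHermitian i
    rw [quad_smul_one, quad_smul_one] at he
    have hN := dot_self_pos hw
    congr 2
    rw [eq_div_iff hα.ne']
    apply mul_right_cancel₀ hN.ne'
    linarith
end

section
/- Let p ∈ S⁺_n and let e be a real symmetric n×n matrix with ⟨e,e⟩_p = tr(p⁻¹ e p⁻¹ e) = 1. If X is a real symmetric matrix solving the Sylvester equation p^{1/2} X + X p^{1/2} = e, then ‖X p^{-1/2}‖_F² = 1/2 − tr(p^{-1/2} X p^{-1/2} X); in particular ‖X p^{-1/2}‖_F² ≤ 1/2. -/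
open Matrix Real Filter

open SPD

/-- The square root squares to `p` and is of the form `B * Bᵀ`. -/
lemma msqrt_facts {n : ℕ} (p : Matrix (Fin n) (Fin n) ℝ) (hp : p.PosDef) :
    msqrt p * msqrt p = p ∧ ∃ B : Matrix (Fin n) (Fin n) ℝ, msqrt p = B * Bᵀ := by
  have hH : p.IsHermitian := hp.isHermitian
  have hm : msqrt p = hH.cfc Real.sqrt := by rw [msqrt, mfun, dif_pos hH]
  constructor
  · rw [hm]
    conv_rhs => rw [hH.spectral_theorem]
    rw [IsHermitian.cfc, ← map_mul, diagonal_mul_diagonal]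
    congr 2
    funext i
    simpa using Real.mul_self_sqrt (hp.eigenvalues_pos i).le
  · refine ⟨(hH.eigenvectorUnitary : Matrix (Fin n) (Fin n) ℝ) *
      diagonal (fun i => Real.sqrt (Real.sqrt (hH.eigenvalues i))), ?_⟩
    rw [hm, IsHermitian.cfc, Unitary.conjStarAlgAut_apply, transpose_mul, diagonal_transpose,
      Matrix.mul_assoc, Matrix.mul_assoc, ← Matrix.mul_assoc (diagonal _) (diagonal _),
      diagonal_mul_diagonal]
    congr 2
    congr 1
    funext i
    simp

/-- If `⟨e,e⟩_p = 1` and `X` solves `p^{1/2} X + X p^{1/2} = e`, then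
`‖X p^{-1/2}‖_F² = 1/2 − tr(p^{-1/2} X p^{-1/2} X) ≤ 1/2`. -/
theorem sylvester_solution_frobenius_bound {n : ℕ}
    (p : Matrix (Fin n) (Fin n) ℝ) (hp : p.PosDef)
    (e : Matrix (Fin n) (Fin n) ℝ) (he : e.IsHermitian)
    (hnorm : (p⁻¹ * e * p⁻¹ * e).trace = 1)
    (X : Matrix (Fin n) (Fin n) ℝ) (hX : X.IsHermitian)
    (hsyl : msqrt p * X + X * msqrt p = e) :
    (X * (msqrt p)⁻¹ * (X * (msqrt p)⁻¹)ᵀ).trace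
        = 1 / 2 - ((msqrt p)⁻¹ * X * (msqrt p)⁻¹ * X).trace
    ∧ (X * (msqrt p)⁻¹ * (X * (msqrt p)⁻¹)ᵀ).trace ≤ 1 / 2 := by
  obtain ⟨hss, B, hB⟩ := msqrt_facts p hp
  have hXT : Xᵀ = X := by simpa using hX.eq
  have hsT : (msqrt p)ᵀ = msqrt p := by rw [hB]; simp
  have hdet : IsUnit (msqrt p).det := by
    have h := hp.det_pos
    rw [← hss, det_mul] at h
    exact isUnit_iff_ne_zero.mpr (fun h0 => by simp [h0] at h)
  have hpinv : p⁻¹ = (msqrt p)⁻¹ * (msqrt p)⁻¹ := by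
    rw [← Matrix.mul_inv_rev, hss]
  have htT : ((msqrt p)⁻¹)ᵀ = (msqrt p)⁻¹ := by rw [transpose_nonsing_inv, hsT]
  have hst := Matrix.mul_nonsing_inv _ hdet
  have hts := Matrix.nonsing_inv_mul _ hdet
  generalize msqrt p = s at *
  generalize s⁻¹ = t at *
  have hte : t * e * t = X * t + t * X := by
    rw [← hsyl]
    calc t * (s * X + X * s) * t = (t * s) * X * t + t * X * (s * t) := by noncomm_ring
      _ = _ := by rw [hst, hts]; simp
  have h1 : ((X * t + t * X) * (X * t + t * X)).trace = 1 := by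
    rw [← hte, ← hnorm, hpinv]
    rw [show t * t * e * (t * t) * e = t * (t * e * t * (t * e)) by noncomm_ring,
      trace_mul_comm t]
    congr 1
    noncomm_ring
  have h2 : ((X * t + t * X) * (X * t + t * X)).trace
      = 2 * (X * t * (t * X)).trace + 2 * (t * X * t * X).trace := by
    rw [show (X * t + t * X) * (X * t + t * X)
      = X * (t * X * t) + X * t * (t * X) + t * (X * X * t) + t * X * t * X by noncomm_ring]
    simp only [trace_add]
    rw [trace_mul_comm X (t * X * t), trace_mul_comm t (X * X * t),
      show X * X * t * t = X * (X * t * t) by noncomm_ring, trace_mul_comm X (X * t * t),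
      show X * t * t * X = X * t * (t * X) by noncomm_ring]
    ring
  have h3 : 0 ≤ (t * X * t * X).trace := by
    have htB : t = (t * B) * (t * B)ᵀ := by
      rw [transpose_mul, htT, show t * B * (Bᵀ * t) = t * (B * Bᵀ) * t by noncomm_ring, ← hB,
        hts, Matrix.one_mul]
    generalize t * B = C at htB
    have h4 : (t * X * t * X).trace = ((Cᵀ * X * C)ᴴ * (Cᵀ * X * C)).trace := by
      rw [htB, show C * Cᵀ * X * (C * Cᵀ) * X = C * (Cᵀ * X * (C * Cᵀ) * X) by noncomm_ring,
        trace_mul_comm C]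
      congr 1
      rw [conjTranspose_eq_transpose_of_trivial]
      simp only [transpose_mul, transpose_transpose, hXT]
      noncomm_ring
    rw [h4]
    exact (posSemidef_conjTranspose_mul_self _).trace_nonneg
  have h5 : (X * t * (X * t)ᵀ).trace = (X * t * (t * X)).trace := by
    rw [transpose_mul, htT, hXT]
  rw [h5]
  constructor <;> linarith
end
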